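/- Let ξ, η ∈ ℝ³ with ξ ≠ 0, η ≠ 0 and ξ − η ≠ 0. Then the mixed derivatives of the phase commute and satisfy S_η Ω_η Φ(ξ,η) = Ω_η S_η Φ(ξ,η) = S_η Φ(ξ,η) · (η_h^⊥·ξ_h)/‖ξ−η‖² + Ω_η Φ(ξ,η) · [ 1 + 2 (η·(ξ−η))/‖ξ−η‖² ]. -/

import Mathlib

/-- Euclidean norm on `ℝ³`. -/
noncomputable def nrm (ξ : Fin 3 → ℝ) : ℝ := Real.sqrt (ξ 0 ^ 2 + ξ 1 ^ 2 + ξ 2 ^ 2)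

/-- The dispersion relation `Λ(ξ) = ξ₃ / ‖ξ‖`. -/
noncomputable def Lam (ξ : Fin 3 → ℝ) : ℝ := ξ 2 / nrm ξ

/-- The phase `Φ(ξ,η) = Λ(ξ) + Λ(ξ−η) + ν Λ(η)`. -/
noncomputable def Phi (ν : ℝ) (ξ η : Fin 3 → ℝ) : ℝ := Lam ξ + Lam (ξ - η) + ν * Lam η

/-- Scaling vector field `S_η f = η · ∇_η f`. -/
noncomputable def SV (f : (Fin 3 → ℝ) → ℝ) : (Fin 3 → ℝ) → ℝ := fun η => fderiv ℝ f η η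

/-- Rotation vector field `Ω_η f = −η₂ ∂_{η₁} f + η₁ ∂_{η₂} f`. -/
noncomputable def OV (f : (Fin 3 → ℝ) → ℝ) : (Fin 3 → ℝ) → ℝ :=
  fun η => fderiv ℝ f η ![-(η 1), η 0, 0]

lemma hasFDerivAt_div {E : Type*} [NormedAddCommGroup E] [NormedSpace ℝ E] {f g : E → ℝ}
    {f' g' : E →L[ℝ] ℝ} {x : E} (hf : HasFDerivAt f f' x) (hg : HasFDerivAt g g' x)
    (h0 : g x ≠ 0) :
    HasFDerivAt (fun y => f y / g y) ((g x)⁻¹ • f' - (f x / g x ^ 2) • g') x := by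
  have h := hf.fun_mul ((hasDerivAt_inv h0).comp_hasFDerivAt x hg)
  refine (h.congr_fderiv (ContinuousLinearMap.ext fun v => ?_)).congr_of_eventuallyEq
    (.of_forall fun y => div_eq_mul_inv _ _)
  simp
  field_simp
  ring

open ContinuousLinearMap in
/-- The linear form `v ↦ p · v` on `ℝ³`. -/
noncomputable def dotForm (p : Fin 3 → ℝ) : (Fin 3 → ℝ) →L[ℝ] ℝ :=
  p 0 • proj 0 + p 1 • proj 1 + p 2 • proj 2

lemma dotForm_apply (p v : Fin 3 → ℝ) :
    dotForm p v = p 0 * v 0 + p 1 * v 1 + p 2 * v 2 := by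
  simp [dotForm]

lemma sum_sq_pos {p : Fin 3 → ℝ} (hp : p ≠ 0) : 0 < p 0 ^ 2 + p 1 ^ 2 + p 2 ^ 2 := by
  by_contra! h
  refine hp (funext fun i => ?_)
  fin_cases i <;> simp <;> nlinarith [sq_nonneg (p 0), sq_nonneg (p 1), sq_nonneg (p 2)]

lemma nrm_pos {p : Fin 3 → ℝ} (hp : p ≠ 0) : 0 < nrm p :=
  Real.sqrt_pos.2 (sum_sq_pos hp)

lemma nrm_sq (p : Fin 3 → ℝ) : nrm p ^ 2 = p 0 ^ 2 + p 1 ^ 2 + p 2 ^ 2 :=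
  Real.sq_sqrt (by positivity)

lemma hasFDerivAt_nrm {p : Fin 3 → ℝ} (hp : p ≠ 0) :
    HasFDerivAt nrm ((nrm p)⁻¹ • dotForm p) p := by
  have hq := ((((hasFDerivAt_apply (𝕜 := ℝ) (0 : Fin 3) p).pow 2).add
    ((hasFDerivAt_apply (𝕜 := ℝ) (1 : Fin 3) p).pow 2)).add
    ((hasFDerivAt_apply (𝕜 := ℝ) (2 : Fin 3) p).pow 2)).sqrt (sum_sq_pos hp).ne'
  refine hq.congr_fderiv (ContinuousLinearMap.ext fun v => ?_)
  have := (nrm_pos hp).ne'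
  simp only [nrm] at this
  simp [dotForm_apply, nrm]
  field_simp

lemma hasFDerivAt_Lam {p : Fin 3 → ℝ} (hp : p ≠ 0) :
    HasFDerivAt Lam ((nrm p)⁻¹ • ContinuousLinearMap.proj 2 - (p 2 / nrm p ^ 3) • dotForm p) p := by
  have h0 := (nrm_pos hp).ne'
  refine (hasFDerivAt_div (hasFDerivAt_apply (𝕜 := ℝ) (2 : Fin 3) p) (hasFDerivAt_nrm hp) h0).congr_fderiv
    (ContinuousLinearMap.ext fun v => ?_)
  simp
  field_simp

lemma fderiv_Phi_apply (ν : ℝ) {ξ η : Fin 3 → ℝ} (hη : η ≠ 0) (hξη : ξ - η ≠ 0)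
    (v : Fin 3 → ℝ) :
    fderiv ℝ (Phi ν ξ) η v =
      -(v 2 / nrm (ξ - η)) + (ξ 2 - η 2) * dotForm (ξ - η) v / nrm (ξ - η) ^ 3 +
        ν * (v 2 / nrm η - η 2 * dotForm η v / nrm η ^ 3) := by
  have h := (((hasFDerivAt_Lam hξη).comp η ((hasFDerivAt_id η).const_sub ξ)).const_add
    (Lam ξ)).add ((hasFDerivAt_Lam hη).const_mul ν)
  have h' : HasFDerivAt (Phi ν ξ) _ η := h
  rw [h'.fderiv]
  simp
  ring

lemma SV_Phi (ν : ℝ) {ξ η : Fin 3 → ℝ} (hη : η ≠ 0) (hξη : ξ - η ≠ 0) :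
    SV (Phi ν ξ) η =
      (ξ 2 - η 2) * dotForm (ξ - η) η / nrm (ξ - η) ^ 3 - η 2 / nrm (ξ - η) := by
  have h0 := (nrm_pos hη).ne'
  have hd : dotForm η η = nrm η ^ 2 := by rw [dotForm_apply, nrm_sq]; ring
  rw [SV, fderiv_Phi_apply ν hη hξη, hd]
  field_simp
  ring

lemma OV_Phi (ν : ℝ) {ξ η : Fin 3 → ℝ} (hη : η ≠ 0) (hξη : ξ - η ≠ 0) :
    OV (Phi ν ξ) η =
      (ξ 2 - η 2) * (η 0 * ξ 1 - η 1 * ξ 0) / nrm (ξ - η) ^ 3 := by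
  rw [OV, fderiv_Phi_apply ν hη hξη]
  simp [dotForm_apply]
  ring

lemma hasFDerivAt_nrm_sub {ξ η : Fin 3 → ℝ} (hξη : ξ - η ≠ 0) :
    HasFDerivAt (fun x => nrm (ξ - x)) (-((nrm (ξ - η))⁻¹ • dotForm (ξ - η))) η :=
  ((hasFDerivAt_nrm hξη).comp η ((hasFDerivAt_id η).const_sub ξ)).congr_fderiv (by ext; simp)

open Filter Topology in
lemma eventually_ne_zero_and_sub_ne_zero {ξ η : Fin 3 → ℝ} (hη : η ≠ 0) (hξη : ξ - η ≠ 0) :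
    ∀ᶠ x in 𝓝 η, x ≠ 0 ∧ ξ - x ≠ 0 :=
  (continuousAt_id.eventually_ne hη).and
    ((continuous_const.sub continuous_id).continuousAt.eventually_ne hξη)

lemma SV_OV_Phi (ν : ℝ) {ξ η : Fin 3 → ℝ} (hη : η ≠ 0) (hξη : ξ - η ≠ 0) :
    SV (OV (Phi ν ξ)) η =
      (η 0 * ξ 1 - η 1 * ξ 0) * ((ξ 2 - 2 * η 2) / nrm (ξ - η) ^ 3 +
        3 * (ξ 2 - η 2) * dotForm (ξ - η) η / nrm (ξ - η) ^ 5) := by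
  have h0 := (nrm_pos hξη).ne'
  have hx (i : Fin 3) := hasFDerivAt_apply (𝕜 := ℝ) i η
  have h := hasFDerivAt_div (((hx 2).const_sub (ξ 2)).fun_mul
    (((hx 0).mul_const (ξ 1)).fun_sub ((hx 1).mul_const (ξ 0))))
    ((hasFDerivAt_nrm_sub hξη).pow 3) (pow_ne_zero 3 h0)
  have he := (eventually_ne_zero_and_sub_ne_zero hη hξη).mono fun x hx => OV_Phi ν hx.1 hx.2
  rw [SV, (h.congr_of_eventuallyEq he).fderiv]
  simp
  field_simp
  ring

lemma OV_SV_Phi (ν : ℝ) {ξ η : Fin 3 → ℝ} (hη : η ≠ 0) (hξη : ξ - η ≠ 0) :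
    OV (SV (Phi ν ξ)) η =
      (η 0 * ξ 1 - η 1 * ξ 0) * ((ξ 2 - 2 * η 2) / nrm (ξ - η) ^ 3 +
        3 * (ξ 2 - η 2) * dotForm (ξ - η) η / nrm (ξ - η) ^ 5) := by
  have h0 := (nrm_pos hξη).ne'
  have hx (i : Fin 3) := hasFDerivAt_apply (𝕜 := ℝ) i η
  have hm (i : Fin 3) := ((hx i).const_sub (ξ i)).fun_mul (hx i)
  have hN := hasFDerivAt_nrm_sub hξη
  have h := (hasFDerivAt_div
    (((hx 2).const_sub (ξ 2)).fun_mul (((hm 0).fun_add (hm 1)).fun_add (hm 2)))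
    (hN.pow 3) (pow_ne_zero 3 h0)).fun_sub (hasFDerivAt_div (hx 2) hN h0)
  have he := (eventually_ne_zero_and_sub_ne_zero hη hξη).mono fun x hx =>
    (SV_Phi ν hx.1 hx.2).trans (by rw [dotForm_apply])
  rw [OV, (h.congr_of_eventuallyEq he).fderiv]
  simp [dotForm_apply]
  field_simp
  ring

/-- The mixed derivatives commute and
`S_ηΩ_ηΦ = Ω_ηS_ηΦ = S_ηΦ·(η_h^⊥·ξ_h)/‖ξ−η‖² + Ω_ηΦ·[1 + 2(η·(ξ−η))/‖ξ−η‖²]`. -/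
theorem stmt7 (ν : ℝ) (hν : ν = 1 ∨ ν = -1) (ξ η : Fin 3 → ℝ)
    (hξ : ξ ≠ 0) (hη : η ≠ 0) (hξη : ξ - η ≠ 0) :
    SV (OV (Phi ν ξ)) η = OV (SV (Phi ν ξ)) η ∧
    SV (OV (Phi ν ξ)) η =
      SV (Phi ν ξ) η * ((-(η 1) * ξ 0 + η 0 * ξ 1) / nrm (ξ - η) ^ 2) +
      OV (Phi ν ξ) η *
        (1 + 2 * ((η 0 * (ξ 0 - η 0) + η 1 * (ξ 1 - η 1) + η 2 * (ξ 2 - η 2)) / nrm (ξ - η) ^ 2)) := by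
  refine ⟨(SV_OV_Phi ν hη hξη).trans (OV_SV_Phi ν hη hξη).symm, ?_⟩
  have h0 := (nrm_pos hξη).ne'
  rw [SV_OV_Phi ν hη hξη, SV_Phi ν hη hξη, OV_Phi ν hη hξη]
  simp only [dotForm_apply, Pi.sub_apply]
  field_simp
  ring
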